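/- Let Λ be an Artin algebra and let M, N be finitely generated Λ-modules. Suppose there exists t ∈ ℕ such that Ω_Λ^t M ≅ Ω_Λ^t N and Ω_Λ^{t−1} M ≇ Ω_Λ^{t−1} N. Then φ(M ⊕ N) ≥ t − 1. -/

import Mathlib

/-! ## Module-level notions: projective covers, syzygies, projective dimension -/

section ModuleLevel

variable (Λ : Type) [Ring Λ]

/-- `f : P → M` is a projective cover: `P` is projective, `f` is surjective, and `f` is an
essential epimorphism (no proper submodule of `P` maps onto `M`). -/
def IsProjCoverMod {P M : Type} [AddCommGroup P] [Module Λ P]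
    [AddCommGroup M] [Module Λ M] (f : P →ₗ[Λ] M) : Prop :=
  Module.Projective Λ P ∧ Function.Surjective f ∧
    ∀ N : Submodule Λ P, Submodule.map f N = ⊤ → N = ⊤

/-- `S` is (isomorphic to) the syzygy of `M`, i.e. the kernel of a projective cover of `M`
by a finitely generated projective module. -/
def IsSyzygyMod (M S : ModuleCat.{0} Λ) : Prop :=
  ∃ (P : ModuleCat.{0} Λ) (f : P →ₗ[Λ] M), Module.Finite Λ P ∧ IsProjCoverMod Λ f ∧
    Nonempty (S ≃ₗ[Λ] LinearMap.ker f)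

/-- `S` is (isomorphic to) an `n`-th syzygy of `M`. -/
def IsNthSyzygyMod : ℕ → ModuleCat.{0} Λ → ModuleCat.{0} Λ → Prop
  | 0 => fun M S => Nonempty (S ≃ₗ[Λ] M)
  | n + 1 => fun M S => ∃ T, IsSyzygyMod Λ M T ∧ IsNthSyzygyMod n T S

/-- The projective dimension of `M` is at least `m`: no syzygy of order `< m` is projective. -/
def pdGE (M : ModuleCat.{0} Λ) (m : ℕ) : Prop :=
  ∀ n : ℕ, n < m → ∀ S : ModuleCat.{0} Λ, IsNthSyzygyMod Λ n M S → ¬ Module.Projective Λ S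

end ModuleLevel

/-! ## The split Grothendieck group `K₀` and the Igusa–Todorov function φ -/

section K0

variable (Λ : Type) [Ring Λ]

/-- The relations defining the split Grothendieck group: `[M] - [N] - [N']` whenever
`M ≅ N ⊕ N'`, and `[P]` for `P` projective. -/
def K0Rels : AddSubgroup (FreeAbelianGroup (FGModuleCat.{0} Λ)) :=
  AddSubgroup.closure
    ({ x | ∃ M N N' : FGModuleCat.{0} Λ, Nonempty (M ≃ₗ[Λ] (N × N')) ∧
        x = FreeAbelianGroup.of M - FreeAbelianGroup.of N - FreeAbelianGroup.of N' } ∪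
     { x | ∃ P : FGModuleCat.{0} Λ, Module.Projective Λ P ∧ x = FreeAbelianGroup.of P })

/-- The split Grothendieck group of the category of finitely generated `Λ`-modules. -/
abbrev K0 := FreeAbelianGroup (FGModuleCat.{0} Λ) ⧸ K0Rels Λ

/-- The class `[M]` of a finitely generated module in `K₀`. -/
def K0mk (M : FGModuleCat.{0} Λ) : K0 Λ :=
  QuotientAddGroup.mk (FreeAbelianGroup.of M)

/-- The subgroup `⟨add M⟩` of `K₀` generated by the classes of direct summands of `M`. -/
def addMSubgroup (M : FGModuleCat.{0} Λ) : AddSubgroup (K0 Λ) :=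
  AddSubgroup.closure
    { x | ∃ N : FGModuleCat.{0} Λ,
        (∃ N' : FGModuleCat.{0} Λ, Nonempty (M ≃ₗ[Λ] (N × N'))) ∧ x = K0mk Λ N }

/-- The rank of a subgroup of `K₀` (as a free abelian group). -/
noncomputable def grk (H : AddSubgroup (K0 Λ)) : Cardinal := Module.rank ℤ H

/-- `Ω` is a syzygy operator: it sends each finitely generated module to (a module isomorphic
to) the kernel of a projective cover of it. -/
def IsSyzygyOperator (Ω : FGModuleCat.{0} Λ → FGModuleCat.{0} Λ) : Prop :=
  ∀ M : FGModuleCat.{0} Λ, ∃ (P : ModuleCat.{0} Λ) (f : P →ₗ[Λ] M),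
    Module.Finite Λ P ∧ IsProjCoverMod Λ f ∧ Nonempty ((Ω M : Type) ≃ₗ[Λ] LinearMap.ker f)

/-- The Igusa–Todorov function φ computed from the endomorphism `L` of `K₀` induced by the
syzygy operator: the least `t` at which the rank of `L^t⟨add M⟩` stabilizes. -/
noncomputable def phiIT (L : AddMonoid.End (K0 Λ)) (M : FGModuleCat.{0} Λ) : ℕ :=
  sInf { t : ℕ | ∀ j : ℕ,
    grk Λ (AddSubgroup.map (L ^ (t + j)) (addMSubgroup Λ M)) =
      grk Λ (AddSubgroup.map (L ^ t) (addMSubgroup Λ M)) }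

end K0

/-! ## Krull–Schmidt decompositions -/

section Decomposition

variable {Λ : Type} [Ring Λ]

/-- A nonzero module of finite length whose endomorphism ring is not local splits nontrivially, by
the Fitting lemma. -/
theorem exists_isCompl_of_not_isLocalRing_end (M : Type) [AddCommGroup M] [Module Λ M]
    [IsArtinian Λ M] [IsNoetherian Λ M] [Nontrivial M] (h : ¬ IsLocalRing (Module.End Λ M)) :
    ∃ p q : Submodule Λ M, IsCompl p q ∧ p ≠ ⊥ ∧ q ≠ ⊥ := by
  by_contra! H
  refine h ⟨fun {a b} hab => ?_⟩
  obtain ⟨n, hn⟩ := Filter.eventually_atTop.1 (LinearMap.eventually_isCompl_ker_pow_range_pow a)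
  have hc := hn (n + 1) (Nat.le_succ n)
  by_cases hk : LinearMap.ker (a ^ (n + 1)) = ⊥
  · left
    have hr : LinearMap.range (a ^ (n + 1)) = ⊤ := by simpa [hk] using hc.sup_eq_top
    have hu : IsUnit (a ^ (n + 1)) := (Module.End.isUnit_iff _).2
      ⟨LinearMap.ker_eq_bot.1 hk, LinearMap.range_eq_top.1 hr⟩
    exact (isUnit_pow_iff n.succ_ne_zero).1 hu
  · right
    have hr := H _ _ hc hk
    have hnil : IsNilpotent a := ⟨n + 1, LinearMap.range_eq_bot.1 hr⟩
    rw [eq_sub_of_add_eq' hab]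
    exact hnil.isUnit_one_sub

/-- A finitely generated nonzero module over an Artinian ring has a direct summand with local
endomorphism ring; modules can be built from zero by successively adding such summands. -/
theorem FGModuleCat.induction_on_local_summands [IsArtinianRing Λ] {p : FGModuleCat.{0} Λ → Prop}
    (zero : ∀ M : FGModuleCat.{0} Λ, Subsingleton M → p M)
    (add : ∀ X M M' : FGModuleCat.{0} Λ, IsLocalRing (Module.End Λ X) →
      Nonempty (M ≃ₗ[Λ] (X × M')) → p M' → p M)
    (M : FGModuleCat.{0} Λ) : p M := by
  have key : ∀ n : ℕ∞, ∀ M : FGModuleCat.{0} Λ, Module.length Λ M = n → Nontrivial M →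
      ∃ X M' : FGModuleCat.{0} Λ, IsLocalRing (Module.End Λ X) ∧ Nonempty (M ≃ₗ[Λ] (X × M')) := by
    intro n
    induction n using WellFoundedLT.induction with
    | ind n ih =>
    intro M hM hMn
    by_cases hl : IsLocalRing (Module.End Λ M)
    · exact ⟨M, FGModuleCat.of Λ PUnit, hl, ⟨LinearEquiv.prodUnique.symm⟩⟩
    · obtain ⟨P, Q, hc, hP, hQ⟩ := exists_isCompl_of_not_isLocalRing_end (Λ := Λ) M hl
      have hPt : P ≠ ⊤ := by
        rintro rfl
        exact hQ (by simpa using hc.inf_eq_bot)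
      obtain ⟨X, P', hX, ⟨e⟩⟩ := ih _ (hM ▸ Submodule.length_lt hPt) (FGModuleCat.of Λ P) rfl
        (Submodule.nontrivial_iff_ne_bot.2 hP)
      exact ⟨X, FGModuleCat.of Λ (P' × Q), hX,
        ⟨(Submodule.prodEquivOfIsCompl P Q hc).symm ≪≫ₗ
          (e.prodCongr (LinearEquiv.refl Λ Q)) ≪≫ₗ LinearEquiv.prodAssoc Λ X P' Q⟩⟩
  generalize hn : Module.length Λ M = n
  induction n using WellFoundedLT.induction generalizing M with
  | ind n ih =>
  rcases subsingleton_or_nontrivial M with hM | hM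
  · exact zero M hM
  · obtain ⟨X, M', hX, ⟨e⟩⟩ := key _ M rfl hM
    refine add X M M' hX ⟨e⟩ (ih _ ?_ M' rfl)
    have : Nontrivial X := by
      by_contra h
      rw [not_nontrivial_iff_subsingleton] at h
      exact one_ne_zero (α := Module.End Λ X) (LinearMap.ext fun x => Subsingleton.elim _ _)
    rw [← hn, e.length_eq, Module.length_prod]
    exact ENat.lt_add_left (Module.length_ne_top (R := Λ) (M := M'))
      (Module.length_pos (R := Λ) (M := X))

/-- A split monomorphism exhibits its domain as a direct summand. -/
theorem nonempty_equiv_prod_ker_of_comp_eq_id {X M : Type} [AddCommGroup X] [Module Λ X]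
    [AddCommGroup M] [Module Λ M] {f : X →ₗ[Λ] M} {g : M →ₗ[Λ] X} (h : g ∘ₗ f = .id) :
    Nonempty (M ≃ₗ[Λ] (X × LinearMap.ker g)) := by
  have hgf : ∀ x, g (f x) = x := LinearMap.congr_fun h
  refine ⟨LinearEquiv.ofBijective
    (g.prod ((LinearMap.id - f ∘ₗ g).codRestrict _ fun x => by simp [hgf])) ⟨?_, ?_⟩⟩
  · rw [← LinearMap.ker_eq_bot, LinearMap.ker_eq_bot']
    intro m hm
    have h1 : g m = 0 := congrArg Prod.fst hm
    have h2 : m - f (g m) = 0 := congrArg (fun z => (z.2 : M)) hm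
    simpa [h1] using h2
  · rintro ⟨x, k, hk⟩
    have hk' : g k = 0 := hk
    refine ⟨f x + k, Prod.ext (by simp [hgf, hk']) (Subtype.ext ?_)⟩
    simp [hgf, hk']

/-- A nonzero direct summand of a module with local endomorphism ring is the whole module. -/
theorem nonempty_equiv_of_comp_eq_id_of_isLocalRing_end {X Y : Type} [AddCommGroup X] [Module Λ X]
    [AddCommGroup Y] [Module Λ Y] [Nontrivial X] [IsLocalRing (Module.End Λ Y)]
    {f : X →ₗ[Λ] Y} {g : Y →ₗ[Λ] X} (h : g ∘ₗ f = .id) : Nonempty (X ≃ₗ[Λ] Y) := by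
  have hgf : ∀ x, g (f x) = x := LinearMap.congr_fun h
  rcases IsLocalRing.isUnit_or_isUnit_of_add_one
    (show (f ∘ₗ g : Module.End Λ Y) + (1 - f ∘ₗ g) = 1 by abel) with hu | hu
  · rw [Module.End.isUnit_iff] at hu
    exact ⟨LinearEquiv.ofBijective f ⟨Function.LeftInverse.injective hgf,
      fun y => (hu.2 y).imp' g fun _ hx => hx⟩⟩
  · rw [Module.End.isUnit_iff] at hu
    obtain ⟨x, hx⟩ := exists_ne (0 : X)
    have : f x = 0 := hu.1 (by simp [hgf])
    exact absurd (by rw [← hgf x, this, map_zero]) hx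

end Decomposition

/-! ## Multiplicities of modules with local endomorphism ring -/

section Multiplicity

variable {Λ : Type} [Ring Λ]

/-- The homomorphisms `X → M` that are not split monomorphisms, which form a submodule if `X` has a
local endomorphism ring. -/
def nonsplitMono (R X M : Type) [CommRing R] [AddCommGroup X] [Module Λ X] [Module R X]
    [SMulCommClass Λ R X] [AddCommGroup M] [Module Λ M] [Module R M]
    [SMulCommClass Λ R M] [LinearMap.CompatibleSMul M X R Λ] [IsLocalRing (Module.End Λ X)] :
    Submodule R (X →ₗ[Λ] M) where
  carrier := { f | ∀ g : M →ₗ[Λ] X, g ∘ₗ f ≠ .id }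
  zero_mem' g hg := zero_ne_one (α := Module.End Λ X) (by
    rwa [LinearMap.comp_zero] at hg)
  add_mem' {f f'} hf hf' g hg := by
    rw [LinearMap.comp_add] at hg
    rcases IsLocalRing.isUnit_or_isUnit_of_add_one
      (show (g ∘ₗ f : Module.End Λ X) + g ∘ₗ f' = 1 from hg) with ⟨u, hu⟩ | ⟨u, hu⟩
    · refine hf ((↑u⁻¹ : Module.End Λ X) ∘ₗ g) ?_
      rw [LinearMap.comp_assoc, ← hu]
      exact u.inv_mul
    · refine hf' ((↑u⁻¹ : Module.End Λ X) ∘ₗ g) ?_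
      rw [LinearMap.comp_assoc, ← hu]
      exact u.inv_mul
  smul_mem' r f hf g hg := hf (r • g) (by
    rw [← hg]
    ext x
    simp [LinearMap.CompatibleSMul.map_smul g r])

theorem comp_mem_nonsplitMono {R X M M' : Type} [CommRing R] [AddCommGroup X] [Module Λ X]
    [Module R X] [SMulCommClass Λ R X] [AddCommGroup M] [Module Λ M] [Module R M]
    [SMulCommClass Λ R M] [LinearMap.CompatibleSMul M X R Λ] [AddCommGroup M'] [Module Λ M']
    [Module R M'] [SMulCommClass Λ R M'] [LinearMap.CompatibleSMul M' X R Λ]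
    [IsLocalRing (Module.End Λ X)] (h : M →ₗ[Λ] M') {f : X →ₗ[Λ] M}
    (hf : f ∈ nonsplitMono (Λ := Λ) R X M) : h ∘ₗ f ∈ nonsplitMono (Λ := Λ) R X M' :=
  fun g hg => hf (g ∘ₗ h) hg

/-- An additive function on `K₀` that detects whether `X` is a direct summand. -/
def IsMultiplicityHom (X : FGModuleCat.{0} Λ) (μ : K0 Λ →+ ℤ) : Prop :=
  (∀ M, 0 ≤ μ (K0mk Λ M)) ∧ 0 < μ (K0mk Λ X) ∧
    ∀ M, μ (K0mk Λ M) ≠ 0 → ∃ (f : X →ₗ[Λ] M) (g : M →ₗ[Λ] X), g ∘ₗ f = .id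

/-- Over an Artin algebra, the multiplicity of a nonprojective module with local endomorphism ring
as a direct summand is (up to a positive factor) an additive function on `K₀`. -/
theorem exists_multiplicity_hom (R : Type) [CommRing R] [IsArtinianRing R] [Algebra R Λ]
    [Module.Finite R Λ] (X : FGModuleCat.{0} Λ) [IsLocalRing (Module.End Λ X)]
    (hX : ¬ Module.Projective Λ X) :
    ∃ μ : K0 Λ →+ ℤ, IsMultiplicityHom X μ := by
  let (M : FGModuleCat.{0} Λ) : Module R M := Module.compHom M (algebraMap R Λ)
  have (M : FGModuleCat.{0} Λ) : IsScalarTower R Λ M := ⟨fun r a m => by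
    rw [Algebra.smul_def, mul_smul]; rfl⟩
  have (M : FGModuleCat.{0} Λ) : SMulCommClass Λ R M := IsScalarTower.to_smulCommClass'
  have (M : FGModuleCat.{0} Λ) : Module.Finite R M := Module.Finite.trans Λ M
  have (M : FGModuleCat.{0} Λ) : IsNoetherian R (X →ₗ[Λ] M) :=
    isNoetherian_of_injective
      ({ toFun := fun f => f.restrictScalars R
         map_add' := fun _ _ => rfl
         map_smul' := fun _ _ => rfl } : (X →ₗ[Λ] M) →ₗ[R] (X →ₗ[R] M))
      (LinearMap.restrictScalars_injective R)
  have (M : FGModuleCat.{0} Λ) : IsArtinian R (X →ₗ[Λ] M) := isArtinian_of_fg_of_artinian'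
  let m (M : FGModuleCat.{0} Λ) : ℤ :=
    (Module.length R ((X →ₗ[Λ] M) ⧸ nonsplitMono (Λ := Λ) R X M)).toNat
  have hm_ne (M : FGModuleCat.{0} Λ) :
      m M ≠ 0 ↔ ∃ (f : X →ₗ[Λ] M) (g : M →ₗ[Λ] X), g ∘ₗ f = .id := by
    simp only [m, ne_eq, Int.natCast_eq_zero, ENat.toNat_eq_zero, Module.length_ne_top, or_false,
      Module.length_eq_zero_iff, Submodule.Quotient.subsingleton_iff, Submodule.eq_top_iff']
    simp [nonsplitMono, ← SetLike.mem_coe]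
  have hm_add (M N N' : FGModuleCat.{0} Λ) (e : M ≃ₗ[Λ] (N × N')) : m M = m N + m N' := by
    let π : (X →ₗ[Λ] M) →ₗ[R] ((X →ₗ[Λ] N) ⧸ nonsplitMono (Λ := Λ) R X N) ×
        ((X →ₗ[Λ] N') ⧸ nonsplitMono (Λ := Λ) R X N') :=
      { toFun := fun f => (Submodule.Quotient.mk (LinearMap.fst Λ N N' ∘ₗ e.toLinearMap ∘ₗ f),
          Submodule.Quotient.mk (LinearMap.snd Λ N N' ∘ₗ e.toLinearMap ∘ₗ f))
        map_add' := fun f f' => by simp [LinearMap.comp_add]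
        map_smul' := fun r f => by
          have h (K : FGModuleCat.{0} Λ) (k : M →ₗ[Λ] K) : k ∘ₗ (r • f) = r • k ∘ₗ f :=
            LinearMap.comp_smul k r f
          simp only [← LinearMap.comp_assoc]
          rw [h N, h N']
          rfl }
    have hπs : Function.Surjective π := by
      rintro ⟨a, b⟩
      obtain ⟨f, rfl⟩ := Submodule.Quotient.mk_surjective _ a
      obtain ⟨f', rfl⟩ := Submodule.Quotient.mk_surjective _ b
      refine ⟨e.symm.toLinearMap ∘ₗ f.prod f', ?_⟩
      simp only [π, LinearMap.coe_mk, AddHom.coe_mk]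
      congr 2 <;> ext x <;> simp
    have hπk : LinearMap.ker π = nonsplitMono (Λ := Λ) R X M := by
      ext f
      simp only [LinearMap.mem_ker, π, LinearMap.coe_mk, AddHom.coe_mk, Prod.mk_eq_zero,
        Submodule.Quotient.mk_eq_zero]
      refine ⟨fun ⟨h, h'⟩ => ?_, fun h =>
        ⟨comp_mem_nonsplitMono (LinearMap.fst Λ N N' ∘ₗ e.toLinearMap) h,
          comp_mem_nonsplitMono (LinearMap.snd Λ N N' ∘ₗ e.toLinearMap) h⟩⟩
      convert add_mem (comp_mem_nonsplitMono (e.symm.toLinearMap ∘ₗ LinearMap.inl Λ N N') h)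
        (comp_mem_nonsplitMono (e.symm.toLinearMap ∘ₗ LinearMap.inr Λ N N') h')
      ext x
      simp [← map_add]
    simp only [m]
    rw [← hπk, (π.quotKerEquivOfSurjective hπs).length_eq, Module.length_prod,
      ENat.toNat_add Module.length_ne_top Module.length_ne_top, Nat.cast_add]
  let μ : K0 Λ →+ ℤ := QuotientAddGroup.lift (K0Rels Λ) (FreeAbelianGroup.lift m) (by
    rw [K0Rels, AddSubgroup.closure_le]
    rintro x (⟨M, N, N', ⟨e⟩, rfl⟩ | ⟨P, hP, rfl⟩)
    · simp [hm_add M N N' e]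
    · by_contra h
      obtain ⟨f, g, hgf⟩ := (hm_ne P).1 (by simpa using h)
      exact hX (Module.Projective.of_split f g hgf))
  have hμ (M : FGModuleCat.{0} Λ) : μ (K0mk Λ M) = m M := by simp [μ, K0mk]
  refine ⟨μ, fun M => ?_, ?_, fun M h => (hm_ne M).1 (hμ M ▸ h)⟩
  · rw [hμ]
    exact Int.natCast_nonneg _
  · rw [hμ]
    exact lt_of_le_of_ne (Int.natCast_nonneg _) ((hm_ne X).2 ⟨.id, .id, rfl⟩).symm

end Multiplicity

/-! ## The structure of `K₀` -/

section K0Structure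

variable {Λ : Type} [Ring Λ]

theorem K0mk_eq_add {M N N' : FGModuleCat.{0} Λ} (e : M ≃ₗ[Λ] (N × N')) :
    K0mk Λ M = K0mk Λ N + K0mk Λ N' := by
  rw [← sub_eq_zero, ← sub_sub]
  exact (QuotientAddGroup.eq_zero_iff _).2 (AddSubgroup.subset_closure (.inl ⟨M, N, N', ⟨e⟩, rfl⟩))

theorem K0mk_eq_zero {P : FGModuleCat.{0} Λ} (hP : Module.Projective Λ P) : K0mk Λ P = 0 :=
  (QuotientAddGroup.eq_zero_iff _).2 (AddSubgroup.subset_closure (.inr ⟨P, hP, rfl⟩))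

theorem K0mk_congr {M N : FGModuleCat.{0} Λ} (e : M ≃ₗ[Λ] N) : K0mk Λ M = K0mk Λ N := by
  have e' : M ≃ₗ[Λ] (N × FGModuleCat.of Λ PUnit) := e ≪≫ₗ LinearEquiv.prodUnique.symm
  rw [K0mk_eq_add e', K0mk_eq_zero (P := FGModuleCat.of Λ PUnit)
    (inferInstanceAs (Module.Projective Λ PUnit)), add_zero]

theorem exists_eq_K0mk_sub_K0mk (z : K0 Λ) :
    ∃ A B : FGModuleCat.{0} Λ, z = K0mk Λ A - K0mk Λ B := by
  obtain ⟨z, rfl⟩ := QuotientAddGroup.mk_surjective z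
  have h0 : K0mk Λ (FGModuleCat.of Λ PUnit) = 0 :=
    K0mk_eq_zero (inferInstanceAs (Module.Projective Λ PUnit))
  induction z using FreeAbelianGroup.induction_on with
  | zero => exact ⟨FGModuleCat.of Λ PUnit, FGModuleCat.of Λ PUnit, by simp⟩
  | of M => exact ⟨M, FGModuleCat.of Λ PUnit, by rw [h0, sub_zero]; rfl⟩
  | neg M _ => exact ⟨FGModuleCat.of Λ PUnit, M, by rw [h0, zero_sub]; rfl⟩
  | add x y hx hy =>
    obtain ⟨A, B, hx⟩ := hx
    obtain ⟨A', B', hy⟩ := hy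
    refine ⟨FGModuleCat.of Λ (A × A'), FGModuleCat.of Λ (B × B'), ?_⟩
    rw [QuotientAddGroup.mk_add, hx, hy,
      K0mk_eq_add (M := FGModuleCat.of Λ (A × A')) (LinearEquiv.refl Λ (A × A')),
      K0mk_eq_add (M := FGModuleCat.of Λ (B × B')) (LinearEquiv.refl Λ (B × B'))]
    abel

/-- A direct summand detected by a multiplicity can be split off. -/
theorem IsMultiplicityHom.exists_equiv_prod [IsNoetherianRing Λ] {X M : FGModuleCat.{0} Λ}
    {μ : K0 Λ →+ ℤ} (hμ : IsMultiplicityHom X μ) (h : μ (K0mk Λ M) ≠ 0) :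
    ∃ M' : FGModuleCat.{0} Λ, Nonempty (M ≃ₗ[Λ] (X × M')) := by
  obtain ⟨f, g, hgf⟩ := hμ.2.2 M h
  exact ⟨FGModuleCat.of Λ (LinearMap.ker g), nonempty_equiv_prod_ker_of_comp_eq_id hgf⟩

/-- Modules with the same multiplicities are isomorphic up to projective direct summands. -/
theorem exists_equiv_prod_projective (R : Type) [CommRing R] [IsArtinianRing R] [Algebra R Λ]
    [Module.Finite R Λ] (A B : FGModuleCat.{0} Λ)
    (h : ∀ X : FGModuleCat.{0} Λ, ∀ μ, IsMultiplicityHom X μ → μ (K0mk Λ A) = μ (K0mk Λ B)) :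
    ∃ C P Q : FGModuleCat.{0} Λ, Module.Projective Λ P ∧ Module.Projective Λ Q ∧
      Nonempty (A ≃ₗ[Λ] (C × P)) ∧ Nonempty (B ≃ₗ[Λ] (C × Q)) := by
  have : IsArtinianRing Λ := .of_finite R Λ
  induction A using FGModuleCat.induction_on_local_summands generalizing B with
  | zero A hA =>
    have hA0 : K0mk Λ A = 0 := K0mk_eq_zero inferInstance
    suffices hB : Module.Projective Λ B from
      ⟨FGModuleCat.of Λ PUnit, A, B, inferInstance, hB, ⟨LinearEquiv.uniqueProd.symm⟩,
        ⟨LinearEquiv.uniqueProd.symm⟩⟩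
    replace h : ∀ X : FGModuleCat.{0} Λ, ∀ μ, IsMultiplicityHom X μ → μ (K0mk Λ B) = 0 :=
      fun X μ hμ => by rw [← h X μ hμ, hA0, map_zero]
    induction B using FGModuleCat.induction_on_local_summands with
    | zero B hB => infer_instance
    | add X B B' hX e ih =>
      obtain ⟨e⟩ := e
      have hXp : Module.Projective Λ X := by
        by_contra hXp
        obtain ⟨μ, hμ⟩ := exists_multiplicity_hom R X hXp
        have := h X μ hμ
        rw [K0mk_eq_add e, map_add] at this
        linarith [hμ.1 B', hμ.2.1]
      have hB' : Module.Projective Λ B' := ih fun Y μ hμ => by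
        rw [← h Y μ hμ, K0mk_eq_add e, K0mk_eq_zero hXp, zero_add]
      exact .of_equiv e.symm
  | add X A A' hX e ih =>
    obtain ⟨e⟩ := e
    by_cases hXp : Module.Projective Λ X
    · obtain ⟨C, P, Q, hP, hQ, ⟨eA⟩, ⟨eB⟩⟩ := ih B fun Y μ hμ => by
        rw [← h Y μ hμ, K0mk_eq_add e, K0mk_eq_zero hXp, zero_add]
      exact ⟨C, FGModuleCat.of Λ (X × P), Q, inferInstanceAs (Module.Projective Λ (X × P)), hQ,
        ⟨e ≪≫ₗ (LinearEquiv.refl Λ X).prodCongr eA ≪≫ₗ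
          (LinearEquiv.prodAssoc Λ X C P).symm ≪≫ₗ
          (LinearEquiv.prodComm Λ X C).prodCongr (LinearEquiv.refl Λ P) ≪≫ₗ
          LinearEquiv.prodAssoc Λ C X P⟩, ⟨eB⟩⟩
    · obtain ⟨μ, hμ⟩ := exists_multiplicity_hom R X hXp
      have hB : μ (K0mk Λ B) ≠ 0 := by
        rw [← h X μ hμ, K0mk_eq_add e, map_add]
        linarith [hμ.1 A', hμ.2.1]
      obtain ⟨B', ⟨eB⟩⟩ := hμ.exists_equiv_prod hB
      obtain ⟨C, P, Q, hP, hQ, ⟨eA'⟩, ⟨eB'⟩⟩ := ih B' fun Y ν hν => by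
        have := h Y ν hν
        rwa [K0mk_eq_add e, K0mk_eq_add eB, map_add, map_add, add_right_inj] at this
      exact ⟨FGModuleCat.of Λ (X × C), P, Q, hP, hQ,
        ⟨e ≪≫ₗ (LinearEquiv.refl Λ X).prodCongr eA' ≪≫ₗ (LinearEquiv.prodAssoc Λ X C P).symm⟩,
        ⟨eB ≪≫ₗ (LinearEquiv.refl Λ X).prodCongr eB' ≪≫ₗ (LinearEquiv.prodAssoc Λ X C Q).symm⟩⟩

theorem K0_eq_zero_of_multiplicityHom (R : Type) [CommRing R] [IsArtinianRing R] [Algebra R Λ]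
    [Module.Finite R Λ] (z : K0 Λ)
    (h : ∀ X : FGModuleCat.{0} Λ, ∀ μ, IsMultiplicityHom X μ → μ z = 0) : z = 0 := by
  obtain ⟨A, B, rfl⟩ := exists_eq_K0mk_sub_K0mk z
  obtain ⟨C, P, Q, hP, hQ, ⟨eA⟩, ⟨eB⟩⟩ := exists_equiv_prod_projective R A B fun X μ hμ => by
    rw [← sub_eq_zero, ← map_sub, h X μ hμ]
  rw [K0mk_eq_add eA, K0mk_eq_add eB, K0mk_eq_zero hP, K0mk_eq_zero hQ, sub_self]

/-- `K₀` of an Artin algebra is torsion-free. -/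
theorem isTorsionFree_K0 (R : Type) [CommRing R] [IsArtinianRing R] [Algebra R Λ]
    [Module.Finite R Λ] : Module.IsTorsionFree ℤ (K0 Λ) := by
  refine .of_smul_eq_zero fun n z hz => or_iff_not_imp_left.2 fun hn => ?_
  refine K0_eq_zero_of_multiplicityHom R z fun X μ hμ => ?_
  have : n * μ z = 0 := by rw [← smul_eq_mul, ← map_zsmul, hz, map_zero]
  exact (mul_eq_zero.1 this).resolve_left hn

/-- A module has finitely many classes of nonprojective summands with local endomorphism ring. -/
theorem exists_finite_K0mk_local_summands [IsArtinianRing Λ] (W : FGModuleCat.{0} Λ) :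
    ∃ T : Set (K0 Λ), T.Finite ∧ ∀ X : FGModuleCat.{0} Λ, IsLocalRing (Module.End Λ X) →
      ∀ μ, IsMultiplicityHom X μ → μ (K0mk Λ W) ≠ 0 → K0mk Λ X ∈ T := by
  induction W using FGModuleCat.induction_on_local_summands with
  | zero W hW =>
    refine ⟨∅, Set.finite_empty, fun X _ μ _ h => h ?_⟩
    rw [K0mk_eq_zero inferInstance, map_zero]
  | add Y W W' hY e ih =>
    obtain ⟨e⟩ := e
    obtain ⟨T, hT, ih⟩ := ih
    refine ⟨insert (K0mk Λ Y) T, hT.insert _, fun X hX μ hμ h => ?_⟩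
    by_cases hW' : μ (K0mk Λ W') = 0
    · left
      rw [K0mk_eq_add e, map_add, hW', add_zero] at h
      obtain ⟨f, g, hgf⟩ := hμ.2.2 Y h
      have : Nontrivial X := by
        by_contra hn
        rw [not_nontrivial_iff_subsingleton] at hn
        exact hμ.2.1.ne' (by rw [K0mk_eq_zero inferInstance, map_zero])
      obtain ⟨e'⟩ := nonempty_equiv_of_comp_eq_id_of_isLocalRing_end hgf
      exact K0mk_congr e'
    · exact .inr (ih X hX μ hμ hW')

theorem finite_addMSubgroup (R : Type) [CommRing R] [IsArtinianRing R] [Algebra R Λ]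
    [Module.Finite R Λ] (W : FGModuleCat.{0} Λ) : Module.Finite ℤ (addMSubgroup Λ W) := by
  have : IsArtinianRing Λ := .of_finite R Λ
  obtain ⟨T, hT, hTW⟩ := exists_finite_K0mk_local_summands W
  have key (N : FGModuleCat.{0} Λ) (hN : ∀ X : FGModuleCat.{0} Λ, ∀ μ, IsMultiplicityHom X μ →
      μ (K0mk Λ N) ≤ μ (K0mk Λ W)) : K0mk Λ N ∈ AddSubgroup.closure T := by
    induction N using FGModuleCat.induction_on_local_summands with
    | zero N _ =>
      rw [K0mk_eq_zero inferInstance]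
      exact zero_mem _
    | add X N N' hX e ih =>
      obtain ⟨e⟩ := e
      rw [K0mk_eq_add e] at hN ⊢
      refine add_mem ?_ (ih fun Y μ hμ => ?_)
      · by_cases hXp : Module.Projective Λ X
        · rw [K0mk_eq_zero hXp]
          exact zero_mem _
        · obtain ⟨μ, hμ⟩ := exists_multiplicity_hom R X hXp
          refine AddSubgroup.subset_closure (hTW X hX μ hμ ?_)
          have := hN X μ hμ
          rw [map_add] at this
          linarith [hμ.1 N', hμ.2.1]
      · have := hN Y μ hμ
        rw [map_add] at this
        linarith [hμ.1 X]
  have hle : addMSubgroup Λ W ≤ AddSubgroup.closure T := by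
    rw [addMSubgroup, AddSubgroup.closure_le]
    rintro _ ⟨N, ⟨N', ⟨e⟩⟩, rfl⟩
    refine key N fun X μ hμ => ?_
    rw [K0mk_eq_add e, map_add]
    linarith [hμ.1 N']
  have : Finite T := hT
  have : Module.Finite ℤ (AddSubgroup.closure T) := Module.Finite.iff_addGroup_fg.2 inferInstance
  exact Module.Finite.of_injective (AddSubgroup.inclusion hle).toIntLinearMap
    (AddSubgroup.inclusion_injective hle)

end K0Structure

/-! ## Uniqueness of syzygies -/

section Syzygy

variable {Λ : Type} [Ring Λ]

/-- Kernels of projective covers of isomorphic modules are isomorphic. -/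
theorem IsProjCoverMod.nonempty_ker_equiv {P P' M M' : Type} [AddCommGroup P] [Module Λ P]
    [AddCommGroup P'] [Module Λ P'] [AddCommGroup M] [Module Λ M] [AddCommGroup M'] [Module Λ M']
    {f : P →ₗ[Λ] M} {f' : P' →ₗ[Λ] M'} (hf : IsProjCoverMod Λ f) (hf' : IsProjCoverMod Λ f')
    (e : M ≃ₗ[Λ] M') : Nonempty (LinearMap.ker f ≃ₗ[Λ] LinearMap.ker f') := by
  obtain ⟨hP, hs, hmin⟩ := hf
  obtain ⟨hP', hs', hmin'⟩ := hf'
  obtain ⟨h, hh⟩ := Module.projective_lifting_property f' (e.toLinearMap ∘ₗ f) hs'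
  have hhs : Function.Surjective h := by
    rw [← LinearMap.range_eq_top]
    apply hmin'
    rw [← LinearMap.range_comp, hh, LinearMap.range_eq_top]
    exact e.surjective.comp hs
  obtain ⟨s, hsh⟩ := Module.projective_lifting_property h .id hhs
  have hfs : f ∘ₗ s = e.symm.toLinearMap ∘ₗ f' := by
    ext x
    have h1 : f' (h (s x)) = e (f (s x)) := LinearMap.congr_fun hh (s x)
    have h2 : h (s x) = x := LinearMap.congr_fun hsh x
    change f (s x) = e.symm (f' x)
    rw [LinearEquiv.eq_symm_apply, ← h1, h2]
  have hss : Function.Surjective s := by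
    rw [← LinearMap.range_eq_top]
    apply hmin
    rw [← LinearMap.range_comp, hfs, LinearMap.range_eq_top]
    exact e.symm.surjective.comp hs'
  have hinj : Function.Injective s := Function.LeftInverse.injective (LinearMap.congr_fun hsh)
  have hk : (LinearMap.ker f').map s = LinearMap.ker f := by
    ext x
    obtain ⟨y, rfl⟩ := hss x
    have hy : f (s y) = e.symm (f' y) := LinearMap.congr_fun hfs y
    simp [hinj.eq_iff, hy]
  exact ⟨(Submodule.equivMapOfInjective s hinj _ ≪≫ₗ LinearEquiv.ofEq _ _ hk).symm⟩

/-- Adding a projective direct summand to a projective cover. -/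
theorem IsProjCoverMod.prodMap_id {P C Q : Type} [AddCommGroup P] [Module Λ P]
    [AddCommGroup C] [Module Λ C] [AddCommGroup Q] [Module Λ Q] (hQ : Module.Projective Λ Q)
    {g : P →ₗ[Λ] C} (hg : IsProjCoverMod Λ g) :
    IsProjCoverMod Λ (g.prodMap (LinearMap.id : Q →ₗ[Λ] Q)) := by
  obtain ⟨hP, hs, hmin⟩ := hg
  refine ⟨inferInstance, hs.prodMap Function.surjective_id, fun N hN => ?_⟩
  have h (c : C) (q : Q) : ∃ p, (p, q) ∈ N ∧ g p = c := by
    obtain ⟨⟨p, q'⟩, hp, hpq⟩ := (hN ▸ Submodule.mem_top : (c, q) ∈ N.map (g.prodMap .id))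
    obtain ⟨rfl, rfl⟩ := Prod.mk.inj hpq
    exact ⟨p, hp, rfl⟩
  have h0 : N.comap (LinearMap.inl Λ P Q) = ⊤ := hmin _ (by
    rw [Submodule.eq_top_iff']
    intro c
    obtain ⟨p, hp, rfl⟩ := h c 0
    exact ⟨p, hp, rfl⟩)
  rw [Submodule.eq_top_iff']
  rintro ⟨p, q⟩
  obtain ⟨p', hp', -⟩ := h 0 q
  have hp : (p - p', (0 : Q)) ∈ N :=
    (h0 ▸ Submodule.mem_top : p - p' ∈ N.comap (LinearMap.inl Λ P Q))
  simpa using add_mem hp hp'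

/-- The syzygy does not change when projective direct summands are split off. -/
theorem IsSyzygyOperator.nonempty_equiv_of_equiv_prod {Ω : FGModuleCat.{0} Λ → FGModuleCat.{0} Λ}
    (hΩ : IsSyzygyOperator Λ Ω) {A C P : FGModuleCat.{0} Λ} (hP : Module.Projective Λ P)
    (e : A ≃ₗ[Λ] (C × P)) : Nonempty (Ω A ≃ₗ[Λ] Ω C) := by
  obtain ⟨PA, f, -, hf, ⟨eA⟩⟩ := hΩ A
  obtain ⟨PC, g, -, hg, ⟨eC⟩⟩ := hΩ C
  obtain ⟨k⟩ := hf.nonempty_ker_equiv (hg.prodMap_id hP) e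
  have hk : (LinearMap.ker g).map (LinearMap.inl Λ PC P) =
      LinearMap.ker (g.prodMap (LinearMap.id : P →ₗ[Λ] P)) := by
    rw [LinearMap.ker_prodMap, LinearMap.ker_id, Submodule.map_inl]
  exact ⟨eA ≪≫ₗ k ≪≫ₗ (Submodule.equivMapOfInjective _ LinearMap.inl_injective _ ≪≫ₗ
    LinearEquiv.ofEq _ _ hk).symm ≪≫ₗ eC.symm⟩

end Syzygy

/-! ## The Igusa–Todorov function and elements of the kernel of the syzygy operator -/

section Phi

variable {Λ : Type} [Ring Λ]

theorem grk_map_le (L : AddMonoid.End (K0 Λ)) (K : AddSubgroup (K0 Λ)) :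
    grk Λ (K.map L) ≤ grk Λ K :=
  LinearMap.rank_le_of_surjective (L.addSubgroupMap K).toIntLinearMap
    (L.addSubgroupMap_surjective K)

theorem map_pow_succ (L : AddMonoid.End (K0 Λ)) (n : ℕ) (K : AddSubgroup (K0 Λ)) :
    K.map (L ^ (n + 1)) = (K.map (L ^ n)).map L := by
  rw [pow_succ']
  exact (AddSubgroup.map_map K L (L ^ n)).symm

/-- The rank drops under an endomorphism that kills a nonzero element. -/
theorem grk_map_lt [Module.IsTorsionFree ℤ (K0 Λ)] (L : AddMonoid.End (K0 Λ))
    (K : AddSubgroup (K0 Λ)) [Module.Finite ℤ K] {y : K0 Λ} (hy : y ∈ K) (hy0 : y ≠ 0)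
    (hLy : L y = 0) : grk Λ (K.map L) < grk Λ K := by
  let l : K →ₗ[ℤ] K.map L := (L.addSubgroupMap K).toIntLinearMap
  have hl : Function.Surjective l := L.addSubgroupMap_surjective K
  have : Module.IsTorsionFree ℤ K :=
    K.subtype_injective.moduleIsTorsionFree _ fun n x => map_zsmul K.subtype n x
  have hker : 0 < Module.rank ℤ (LinearMap.ker l) :=
    rank_pos_iff_exists_ne_zero.2 ⟨⟨⟨y, hy⟩, Subtype.ext hLy⟩, fun h =>
      hy0 (congrArg (fun z : LinearMap.ker l => ((z : K) : K0 Λ)) h)⟩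
  have : Module.Finite ℤ (K.map L) := .of_surjective l hl
  have h := LinearMap.rank_eq_of_surjective hl
  unfold grk
  rw [← Module.finrank_eq_rank, ← Module.finrank_eq_rank] at h ⊢
  rw [← Module.finrank_eq_rank] at h hker
  norm_cast at h hker ⊢
  omega

/-- The ranks in the definition of `phiIT` stabilize. -/
theorem phiIT_spec (L : AddMonoid.End (K0 Λ)) (W : FGModuleCat.{0} Λ) (j : ℕ) :
    grk Λ (AddSubgroup.map (L ^ (phiIT Λ L W + j)) (addMSubgroup Λ W)) =
      grk Λ (AddSubgroup.map (L ^ phiIT Λ L W) (addMSubgroup Λ W)) := by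
  let r (n : ℕ) := grk Λ (AddSubgroup.map (L ^ n) (addMSubgroup Λ W))
  have hr : Antitone r := antitone_nat_of_succ_le fun n => by
    simp only [r, map_pow_succ]
    exact grk_map_le L _
  obtain ⟨_, ⟨n, rfl⟩, hmin⟩ := WellFounded.has_min (wellFounded_lt (α := Cardinal)) (Set.range r)
    ⟨_, 0, rfl⟩
  have hne : { t : ℕ | ∀ j : ℕ, r (t + j) = r t }.Nonempty :=
    ⟨n, fun j => (hr (Nat.le_add_right n j)).antisymm (not_lt.1 (hmin _ ⟨n + j, rfl⟩))⟩
  exact Nat.sInf_mem hne j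

theorem lt_phiIT [Module.IsTorsionFree ℤ (K0 Λ)] (L : AddMonoid.End (K0 Λ)) (W : FGModuleCat.{0} Λ)
    [Module.Finite ℤ (addMSubgroup Λ W)] {x : K0 Λ} (hx : x ∈ addMSubgroup Λ W) {s : ℕ}
    (hs : (L ^ s) x ≠ 0) (hs' : (L ^ (s + 1)) x = 0) : s < phiIT Λ L W := by
  by_contra! h
  have : Module.Finite ℤ ((addMSubgroup Λ W).map (L ^ s)) :=
    .of_surjective ((L ^ s).addSubgroupMap (addMSubgroup Λ W)).toIntLinearMap
      ((L ^ s).addSubgroupMap_surjective _)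
  rw [pow_succ'] at hs'
  have hlt := grk_map_lt L _ (AddSubgroup.mem_map_of_mem (L ^ s) hx) hs hs'
  obtain ⟨j, rfl⟩ := Nat.exists_eq_add_of_le h
  rw [← map_pow_succ, phiIT_spec, add_assoc, phiIT_spec] at hlt
  exact lt_irrefl _ hlt

theorem pow_K0mk {Ω : FGModuleCat.{0} Λ → FGModuleCat.{0} Λ} {L : AddMonoid.End (K0 Λ)}
    (hL : ∀ M : FGModuleCat.{0} Λ, L (K0mk Λ M) = K0mk Λ (Ω M)) (n : ℕ) (M : FGModuleCat.{0} Λ) :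
    (L ^ n) (K0mk Λ M) = K0mk Λ (Ω^[n] M) := by
  induction n with
  | zero => rfl
  | succ n ih =>
    rw [pow_succ', Function.iterate_succ_apply', ← hL, ← ih]
    rfl

end Phi

theorem phi_lower_bound_of_syzygies
    (R : Type) [CommRing R] [IsArtinianRing R]
    (Λ : Type) [Ring Λ] [Algebra R Λ] [Module.Finite R Λ]
    (Ω : FGModuleCat.{0} Λ → FGModuleCat.{0} Λ) (hΩ : IsSyzygyOperator Λ Ω)
    (L : AddMonoid.End (K0 Λ)) (hL : ∀ M : FGModuleCat.{0} Λ, L (K0mk Λ M) = K0mk Λ (Ω M))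
    (M N : FGModuleCat.{0} Λ) (t : ℕ) (ht : 1 ≤ t)
    (hiso : Nonempty ((Ω^[t] M : Type) ≃ₗ[Λ] (Ω^[t] N : Type)))
    (hniso : ¬ Nonempty ((Ω^[t-1] M : Type) ≃ₗ[Λ] (Ω^[t-1] N : Type))) :
    t - 1 ≤ phiIT Λ L (FGModuleCat.of Λ (↥M × ↥N)) := by
  obtain _ | _ | n := t
  · omega
  · exact Nat.zero_le _
  have := isTorsionFree_K0 (Λ := Λ) R
  set W : FGModuleCat.{0} Λ := FGModuleCat.of Λ (↥M × ↥N)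
  have := finite_addMSubgroup R W
  let x := K0mk Λ M - K0mk Λ N
  have hx : x ∈ addMSubgroup Λ W := sub_mem
    (AddSubgroup.subset_closure ⟨M, ⟨N, ⟨LinearEquiv.refl Λ (M × N)⟩⟩, rfl⟩)
    (AddSubgroup.subset_closure ⟨N, ⟨M, ⟨LinearEquiv.prodComm Λ M N⟩⟩, rfl⟩)
  have hLx (k : ℕ) : (L ^ k) x = K0mk Λ (Ω^[k] M) - K0mk Λ (Ω^[k] N) := by
    rw [map_sub, pow_K0mk hL, pow_K0mk hL]
  have hx2 : (L ^ (n + 2)) x = 0 := by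
    obtain ⟨e⟩ := hiso
    rw [hLx, K0mk_congr e, sub_self]
  have hx0 : (L ^ n) x ≠ 0 := by
    intro h
    rw [hLx, sub_eq_zero] at h
    obtain ⟨C, P, Q, hP, hQ, ⟨eM⟩, ⟨eN⟩⟩ :=
      exists_equiv_prod_projective R (Ω^[n] M) (Ω^[n] N) fun _ μ _ => congrArg μ h
    obtain ⟨e⟩ := hΩ.nonempty_equiv_of_equiv_prod hP eM
    obtain ⟨e'⟩ := hΩ.nonempty_equiv_of_equiv_prod hQ eN
    refine hniso ?_
    rw [Nat.add_sub_cancel, Function.iterate_succ_apply', Function.iterate_succ_apply']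
    exact ⟨e ≪≫ₗ e'.symm⟩
  by_cases hx1 : (L ^ (n + 1)) x = 0
  · exact lt_phiIT L W hx hx0 hx1
  · exact (lt_phiIT L W hx hx1 hx2).le
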